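/- For all homogeneous divergence-free polynomial polyvector fields α, β, γ on ℂ^d one has τ(∂(αβ)·γ) + (−1)^{|α|} τ(α·∂(βγ)) + (−1)^{(|α|+1)|β|} τ(β·∂(αγ)) = 0. (This is the 2-cocycle identity for the pairing c(α,β) = τ(αβ) that exhibits the one-dimensional central extension appearing in the minimal model of minimal BCOV theory with (d−1)-potentials on ℂ^d.) -/

import Mathlib

/-!
Setup: the supercommutative algebra `A = ℂ[x_1,…,x_d] ⊗ Λ[ξ_1,…,ξ_d]`
of polynomial polyvector fields on `ℂ^d`, encoded by coefficients: an element
`f : PVA d` assigns to each finite set `S ⊆ Fin d` the polynomial coefficient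
of the monomial `ξ_S` (the product of the `ξ_i`, `i ∈ S`, in increasing order).
-/

noncomputable section

namespace BCOV

/-- Polynomial coefficient ring `ℂ[x_1,…,x_d]`. -/
abbrev MPoly (d : ℕ) : Type := MvPolynomial (Fin d) ℂ

/-- The algebra `A` of polynomial polyvector fields on `ℂ^d`. -/
abbrev PVA (d : ℕ) : Type := Finset (Fin d) → MPoly d

variable {d : ℕ}

/-- Koszul sign arising when multiplying `ξ_T · ξ_U` for disjoint `T`, `U`. -/
def koszulSign (T U : Finset (Fin d)) : ℂ :=
  (-1 : ℂ) ^ (((T ×ˢ U).filter fun p : (Fin d) × (Fin d) => p.2 < p.1).card)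

/-- The supercommutative product on `A`. -/
def mul (f g : PVA d) : PVA d := fun S =>
  ∑ T ∈ S.powerset, koszulSign T (S \ T) • (f T * g (S \ T))

/-- The even partial derivative `∂/∂x_i`. -/
def Dx (i : Fin d) (f : PVA d) : PVA d := fun S => MvPolynomial.pderiv i (f S)

/-- The left odd partial derivative `∂/∂ξ_i`. -/
def Dxi (i : Fin d) (f : PVA d) : PVA d := fun S =>
  if i ∈ S then 0
  else ((-1 : ℂ) ^ ((S.filter fun j => j < i).card)) • f (insert i S)

/-- The divergence operator `∂ = Σ_i ∂_{x_i} ∂_{ξ_i}` (with respect to the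
standard holomorphic volume form). -/
def dvg (f : PVA d) : PVA d := ∑ i : Fin d, Dx i (Dxi i f)

/-- `f` lies in `PV^j`: only coefficients of `ξ`-monomials of length `j` occur. -/
def IsHomog (j : ℕ) (f : PVA d) : Prop :=
  ∀ S : Finset (Fin d), S.card ≠ j → f S = 0

/-- The Schouten–Nijenhuis bracket `[f, g]` of `f ∈ PV^a` with `g`:
`[f,g] = (−1)^{a−1} (∂(fg) − (∂f)g − (−1)^a f (∂g))`. -/
def sn (a : ℕ) (f g : PVA d) : PVA d :=
  ((-1 : ℂ) ^ (a + 1)) •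
    (dvg (mul f g) - mul (dvg f) g - ((-1 : ℂ) ^ a) • mul f (dvg g))

/-- The top polyvector field `ξ_1 ⋯ ξ_d`. -/
def xiTop : PVA d := fun S => if S = Finset.univ then 1 else 0

/-- `τ`: the value at `x = 0` of the coefficient of `ξ_1 ⋯ ξ_d`. -/
def tauA (f : PVA d) : ℂ := MvPolynomial.constantCoeff (f Finset.univ)

/-- `σ`: the constant term. -/
def sigmaA (f : PVA d) : ℂ := MvPolynomial.constantCoeff (f ∅)

theorem koszulSign_eq_prod (T U : Finset (Fin d)) :
    koszulSign T U = ∏ t ∈ T, ∏ u ∈ U, (if u < t then (-1 : ℂ) else 1) := by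
  rw [← Finset.prod_product', Finset.prod_ite]
  simp [koszulSign]

theorem koszulSign_union_left {T T' : Finset (Fin d)} (h : Disjoint T T') (U : Finset (Fin d)) :
    koszulSign (T ∪ T') U = koszulSign T U * koszulSign T' U := by
  simp only [koszulSign_eq_prod, Finset.prod_union h]

theorem koszulSign_union_right (T : Finset (Fin d)) {U U' : Finset (Fin d)} (h : Disjoint U U') :
    koszulSign T (U ∪ U') = koszulSign T U * koszulSign T U' := by
  simp only [koszulSign_eq_prod, Finset.prod_union h, Finset.prod_mul_distrib]

theorem koszulSign_mul_self (T U : Finset (Fin d)) : koszulSign T U * koszulSign T U = 1 := by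
  rw [koszulSign, ← mul_pow]
  simp

theorem koszulSign_comm {T U : Finset (Fin d)} (h : Disjoint T U) :
    koszulSign T U = (-1) ^ (T.card * U.card) * koszulSign U T := by
  have hconst : ((-1 : ℂ)) ^ (T.card * U.card) = ∏ t ∈ T, ∏ u ∈ U, (-1 : ℂ) := by
    simp [← pow_mul, mul_comm]
  rw [hconst, koszulSign_eq_prod, koszulSign_eq_prod, Finset.prod_comm (s := U),
    ← Finset.prod_mul_distrib]
  refine Finset.prod_congr rfl fun t ht => ?_
  rw [← Finset.prod_mul_distrib]
  refine Finset.prod_congr rfl fun u hu => ?_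
  rcases lt_trichotomy u t with hlt | heq | hgt
  · simp [hlt, hlt.not_gt]
  · exact absurd heq.symm (Finset.disjoint_iff_ne.mp h t ht u hu)
  · simp [hgt, hgt.not_gt]

theorem koszulSign_singleton_left (i : Fin d) (U : Finset (Fin d)) :
    koszulSign {i} U = (-1) ^ (U.filter fun j => j < i).card := by
  rw [koszulSign_eq_prod, Finset.prod_singleton, Finset.prod_ite]
  simp

theorem koszulSign_insert_left {i : Fin d} {T : Finset (Fin d)} (hi : i ∉ T)
    (U : Finset (Fin d)) :
    koszulSign (insert i T) U = koszulSign {i} U * koszulSign T U := by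
  rw [Finset.insert_eq, koszulSign_union_left (Finset.disjoint_singleton_left.mpr hi)]

theorem koszulSign_insert_right {i : Fin d} {T U : Finset (Fin d)} (hT : i ∉ T) (hU : i ∉ U) :
    koszulSign T (insert i U) = (-1) ^ T.card * koszulSign {i} T * koszulSign T U := by
  rw [Finset.insert_eq, koszulSign_union_right _ (Finset.disjoint_singleton_left.mpr hU),
    koszulSign_comm (Finset.disjoint_singleton_right.mpr hT)]
  simp

theorem Dxi_apply_of_mem {i : Fin d} {S : Finset (Fin d)} (h : i ∈ S) (f : PVA d) :
    Dxi i f S = 0 := by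
  simp [Dxi, h]

theorem Dxi_apply_of_notMem {i : Fin d} {S : Finset (Fin d)} (h : i ∉ S) (f : PVA d) :
    Dxi i f S = koszulSign {i} S • f (insert i S) := by
  simp [Dxi, h, koszulSign_singleton_left]

/-- `f` is homogeneous for the `ℤ/2`-grading, of the same parity as `a`. -/
def HasParity (a : ℕ) (f : PVA d) : Prop :=
  ∀ S : Finset (Fin d), f S ≠ 0 → (-1 : ℂ) ^ S.card = (-1) ^ a

theorem IsHomog.hasParity {a : ℕ} {f : PVA d} (h : IsHomog a f) : HasParity a f := by
  intro S hS
  rw [not_imp_comm.mp (h S) hS]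

theorem HasParity.Dx {a : ℕ} {f : PVA d} (h : HasParity a f) (i : Fin d) :
    HasParity a (Dx i f) := by
  intro S hS
  refine h S fun h0 => hS ?_
  simp [BCOV.Dx, h0]

theorem HasParity.Dxi {a : ℕ} {f : PVA d} (h : HasParity a f) (i : Fin d) :
    HasParity (a + 1) (Dxi i f) := by
  intro S hS
  by_cases hi : i ∈ S
  · exact absurd (Dxi_apply_of_mem hi f) hS
  · rw [Dxi_apply_of_notMem hi] at hS
    have := h _ (right_ne_zero_of_smul hS)
    rw [Finset.card_insert_of_notMem hi] at this
    rw [pow_succ, ← this]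
    ring

section Bilinearity

variable (f g h : PVA d)

theorem add_mul' : mul (f + g) h = mul f h + mul g h := by
  funext S
  simp [mul, add_mul, Finset.sum_add_distrib]

theorem mul_add' : mul f (g + h) = mul f g + mul f h := by
  funext S
  simp [mul, mul_add, Finset.sum_add_distrib]

theorem smul_mul' (r : ℂ) : mul (r • f) g = r • mul f g := by
  funext S
  simp [mul, Finset.smul_sum, smul_comm r]

theorem mul_smul' (r : ℂ) : mul f (r • g) = r • mul f g := by
  funext S
  simp [mul, Finset.smul_sum, smul_comm r]

theorem zero_mul' : mul 0 f = 0 := by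
  funext S
  simp [mul]

theorem mul_zero' : mul f 0 = 0 := by
  funext S
  simp [mul]

theorem sum_mul' {ι : Type*} (s : Finset ι) (F : ι → PVA d) :
    mul (∑ i ∈ s, F i) g = ∑ i ∈ s, mul (F i) g := by
  classical
  induction s using Finset.induction_on with
  | empty => simp [zero_mul']
  | insert i s hi ih => rw [Finset.sum_insert hi, Finset.sum_insert hi, add_mul', ih]

theorem mul_sum' {ι : Type*} (s : Finset ι) (F : ι → PVA d) :
    mul f (∑ i ∈ s, F i) = ∑ i ∈ s, mul f (F i) := by
  classical
  induction s using Finset.induction_on with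
  | empty => simp [mul_zero']
  | insert i s hi ih => rw [Finset.sum_insert hi, Finset.sum_insert hi, mul_add', ih]

end Bilinearity

theorem mul_assoc' (f g h : PVA d) : mul (mul f g) h = mul f (mul g h) := by
  funext S
  simp only [mul, Finset.sum_mul, Finset.mul_sum, Finset.smul_sum]
  rw [Finset.sum_sigma', Finset.sum_sigma']
  refine Finset.sum_bij' (fun p _ => ⟨p.2, p.1 \ p.2⟩) (fun p _ => ⟨p.1 ∪ p.2, p.1⟩) ?_ ?_ ?_ ?_ ?_
  · rintro ⟨T, W⟩ hp
    simp only [Finset.mem_sigma, Finset.mem_powerset] at hp ⊢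
    exact ⟨hp.2.trans hp.1, Finset.sdiff_subset_sdiff hp.1 subset_rfl⟩
  · rintro ⟨W, V⟩ hp
    simp only [Finset.mem_sigma, Finset.mem_powerset] at hp ⊢
    exact ⟨Finset.union_subset hp.1 (hp.2.trans Finset.sdiff_subset), Finset.subset_union_left⟩
  · rintro ⟨T, W⟩ hp
    simp only [Finset.mem_sigma, Finset.mem_powerset] at hp
    simp [Finset.union_sdiff_of_subset hp.2]
  · rintro ⟨W, V⟩ hp
    simp only [Finset.mem_sigma, Finset.mem_powerset] at hp
    have hWV : Disjoint W V := Finset.disjoint_of_subset_right hp.2 Finset.disjoint_sdiff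
    simp [Finset.union_sdiff_cancel_left hWV]
  · rintro ⟨T, W⟩ hp
    simp only [Finset.mem_sigma, Finset.mem_powerset] at hp
    obtain ⟨hTS, hWT⟩ := hp
    have hX : (S \ W) \ (T \ W) = S \ T := by
      rw [sdiff_sdiff_left, Finset.sup_eq_union, Finset.union_sdiff_of_subset hWT]
    have hSW : S \ W = T \ W ∪ S \ T := by
      rw [← hX, Finset.union_sdiff_of_subset (Finset.sdiff_subset_sdiff hTS subset_rfl)]
    have hT : koszulSign T (S \ T) = koszulSign W (S \ T) * koszulSign (T \ W) (S \ T) := by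
      rw [← koszulSign_union_left Finset.disjoint_sdiff, Finset.union_sdiff_of_subset hWT]
    have hW : koszulSign W (S \ W) = koszulSign W (T \ W) * koszulSign W (S \ T) := by
      rw [hSW, koszulSign_union_right]
      exact Finset.disjoint_of_subset_left Finset.sdiff_subset Finset.disjoint_sdiff
    simp only [hX, hT, hW, smul_mul_assoc, mul_smul_comm, smul_smul, mul_assoc]
    congr 1
    ring

theorem mul_comm_of_hasParity {a b : ℕ} {f g : PVA d} (hf : HasParity a f) (hg : HasParity b g) :
    mul f g = (-1 : ℂ) ^ (a * b) • mul g f := by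
  funext S
  simp only [mul, Pi.smul_apply, Finset.smul_sum]
  refine Finset.sum_bij' (fun T _ => S \ T) (fun T _ => S \ T) ?_ ?_ ?_ ?_ ?_
  · simp
  · simp
  · intro T hT
    simp [Finset.sdiff_sdiff_eq_self (Finset.mem_powerset.mp hT)]
  · intro T hT
    simp [Finset.sdiff_sdiff_eq_self (Finset.mem_powerset.mp hT)]
  · intro T hT
    rw [Finset.sdiff_sdiff_eq_self (Finset.mem_powerset.mp hT)]
    by_cases hfT : f T = 0
    · simp [hfT]
    by_cases hgT : g (S \ T) = 0
    · simp [hgT]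
    rw [koszulSign_comm Finset.disjoint_sdiff, pow_mul, hf T hfT, ← pow_mul, mul_comm a, pow_mul,
      hg _ hgT, ← pow_mul, mul_comm b, smul_smul, mul_comm (f T)]

theorem Dx_mul (i : Fin d) (f g : PVA d) :
    Dx i (mul f g) = mul (Dx i f) g + mul f (Dx i g) := by
  funext S
  simp only [Dx, mul, Pi.add_apply, map_sum, ← Finset.sum_add_distrib, ← smul_add]
  refine Finset.sum_congr rfl fun T _ => ?_
  rw [Derivation.map_smul, Derivation.leibniz]
  simp only [smul_eq_mul]
  congr 1
  ring

theorem Dx_add (i : Fin d) (f g : PVA d) : Dx i (f + g) = Dx i f + Dx i g := by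
  funext S
  simp [Dx]

theorem Dx_smul (i : Fin d) (r : ℂ) (f : PVA d) : Dx i (r • f) = r • Dx i f := by
  funext S
  simp [Dx]

theorem Dxi_mul (i : Fin d) {a : ℕ} {f : PVA d} (hf : HasParity a f) (g : PVA d) :
    Dxi i (mul f g) = mul (Dxi i f) g + (-1 : ℂ) ^ a • mul f (Dxi i g) := by
  funext S
  have hparity (T : Finset (Fin d)) (r : ℂ) (p : MPoly d) :
      ((-1 : ℂ) ^ a * r) • (f T * p) = ((-1) ^ T.card * r) • (f T * p) := by
    by_cases h : f T = 0
    · simp [h]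
    · rw [hf T h]
  simp only [Pi.add_apply, Pi.smul_apply]
  by_cases hi : i ∈ S
  · rw [Dxi_apply_of_mem hi]
    obtain ⟨R, hiR, rfl⟩ : ∃ R, i ∉ R ∧ S = insert i R :=
      ⟨S.erase i, Finset.notMem_erase i S, (Finset.insert_erase hi).symm⟩
    simp only [mul]
    rw [Finset.sum_powerset_insert hiR, Finset.sum_powerset_insert hiR, smul_add,
      Finset.smul_sum, Finset.smul_sum, ← Finset.sum_add_distrib, ← Finset.sum_add_distrib,
      ← Finset.sum_add_distrib]
    refine (Finset.sum_eq_zero fun T hT => ?_).symm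
    have hiT : i ∉ T := fun h => hiR (Finset.mem_powerset.mp hT h)
    have hiU : i ∉ R \ T := fun h => hiR (Finset.sdiff_subset h)
    have hU : insert i R \ insert i T = R \ T := by
      rw [Finset.insert_sdiff_insert, Finset.sdiff_insert_of_notMem hiR]
    rw [Finset.insert_sdiff_of_notMem _ hiT, hU, Dxi_apply_of_mem (Finset.mem_insert_self i T),
      Dxi_apply_of_mem (Finset.mem_insert_self i (R \ T)), Dxi_apply_of_notMem hiT,
      Dxi_apply_of_notMem hiU, koszulSign_insert_right hiT hiU, koszulSign_insert_left hiT]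
    simp only [smul_mul_assoc, mul_smul_comm, smul_smul, zero_mul, mul_zero, smul_zero, add_zero,
      zero_add]
    rw [hparity, Finset.card_insert_of_notMem hiT, ← add_smul]
    refine (congrArg (· • _) ?_).trans (zero_smul ℂ _)
    linear_combination (-1 : ℂ) ^ T.card * koszulSign T (R \ T) *
      (koszulSign_mul_self {i} T - koszulSign_mul_self {i} (R \ T))
  · rw [Dxi_apply_of_notMem hi]
    simp only [mul]
    rw [Finset.sum_powerset_insert hi, ← Finset.sum_add_distrib, Finset.smul_sum, Finset.smul_sum,
      ← Finset.sum_add_distrib]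
    refine Finset.sum_congr rfl fun T hT => ?_
    rw [Finset.mem_powerset] at hT
    have hiT : i ∉ T := fun h => hi (hT h)
    have hiU : i ∉ S \ T := fun h => hi (Finset.sdiff_subset h)
    have hU : insert i S \ insert i T = S \ T := by
      rw [Finset.insert_sdiff_insert, Finset.sdiff_insert_of_notMem hi]
    have hS : koszulSign {i} S = koszulSign {i} T * koszulSign {i} (S \ T) := by
      rw [← koszulSign_union_right _ Finset.disjoint_sdiff, Finset.union_sdiff_of_subset hT]
    rw [Finset.insert_sdiff_of_notMem _ hiT, hU, Dxi_apply_of_notMem hiT,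
      Dxi_apply_of_notMem hiU, koszulSign_insert_right hiT hiU, koszulSign_insert_left hiT]
    simp only [smul_mul_assoc, mul_smul_comm, smul_smul, smul_add]
    rw [hparity, hS, add_comm]
    congr 2
    · linear_combination koszulSign {i} T * koszulSign T (S \ T) *
        koszulSign_mul_self {i} (S \ T)
    · linear_combination (-1 : ℂ) ^ T.card * koszulSign T (S \ T) *
        koszulSign {i} (S \ T) * koszulSign_mul_self {i} T

theorem dvg_mul {a : ℕ} {f : PVA d} (hf : HasParity a f) (g : PVA d) :
    dvg (mul f g) = mul (dvg f) g + (-1 : ℂ) ^ a • mul f (dvg g) +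
      ∑ i, (mul (Dxi i f) (Dx i g) + (-1 : ℂ) ^ a • mul (Dx i f) (Dxi i g)) := by
  simp only [dvg, sum_mul', mul_sum', Finset.smul_sum, ← Finset.sum_add_distrib]
  refine Finset.sum_congr rfl fun i _ => ?_
  rw [Dxi_mul i hf, Dx_add, Dx_smul, Dx_mul, Dx_mul, smul_add]
  abel

theorem dvg_mul_of_dvg_eq_zero {a : ℕ} {f g : PVA d} (hf : HasParity a f) (hdf : dvg f = 0)
    (hdg : dvg g = 0) :
    dvg (mul f g) =
      ∑ i, (mul (Dxi i f) (Dx i g) + (-1 : ℂ) ^ a • mul (Dx i f) (Dxi i g)) := by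
  rw [dvg_mul hf, hdf, hdg, zero_mul', mul_zero']
  simp

/-- The second-order Leibniz rule for `∂` on divergence-free arguments. -/
theorem dvg_mul_mul {a b : ℕ} {f g h : PVA d} (hf : HasParity a f) (hg : HasParity b g)
    (hdf : dvg f = 0) (hdg : dvg g = 0) (hdh : dvg h = 0) :
    dvg (mul f (mul g h)) = mul (dvg (mul f g)) h + (-1 : ℂ) ^ a • mul f (dvg (mul g h)) +
      (-1 : ℂ) ^ ((a + 1) * b) • mul g (dvg (mul f h)) := by
  rw [dvg_mul hf (mul g h), hdf, zero_mul', zero_add, dvg_mul_of_dvg_eq_zero hf hdf hdg,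
    dvg_mul_of_dvg_eq_zero hf hdf hdh, add_comm, add_right_comm, add_left_inj, sum_mul', mul_sum',
    Finset.smul_sum, ← Finset.sum_add_distrib]
  refine Finset.sum_congr rfl fun i _ => ?_
  have hs : (-1 : ℂ) ^ a * ((-1) ^ b * (-1) ^ (a * b)) = (-1) ^ ((a + 1) * b) * (-1) ^ a := by
    ring
  rw [Dx_mul, Dxi_mul i hg, mul_add', mul_add', mul_smul', add_mul', smul_mul', mul_add', mul_smul',
    ← mul_assoc', ← mul_assoc', ← mul_assoc', ← mul_assoc',
    mul_comm_of_hasParity (hf.Dxi i) hg, mul_comm_of_hasParity (hf.Dx i) hg, smul_mul', smul_mul',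
    mul_assoc' g, mul_assoc' g]
  simp only [smul_add, smul_smul, hs]
  abel

theorem tauA_add (f g : PVA d) : tauA (f + g) = tauA f + tauA g := by
  simp [tauA]

theorem tauA_smul (r : ℂ) (f : PVA d) : tauA (r • f) = r * tauA f := by
  simp [tauA]

theorem tauA_dvg (f : PVA d) : tauA (dvg f) = 0 := by
  simp [tauA, dvg, Dx, Dxi]

/-- For all homogeneous divergence-free polynomial polyvector
fields `α, β, γ` on `ℂ^d` one has
`τ(∂(αβ)·γ) + (−1)^{|α|} τ(α·∂(βγ)) + (−1)^{(|α|+1)|β|} τ(β·∂(αγ)) = 0`.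
(This is the 2-cocycle identity for the pairing `c(α,β) = τ(αβ)` exhibiting the
one-dimensional central extension appearing in the minimal model of minimal
BCOV theory with `(d−1)`-potentials on `ℂ^d`.) -/
theorem tau_cocycle (d : ℕ) (hd : 1 ≤ d) (a b c : ℕ) (α β γ : PVA d)
    (hα0 : α ≠ 0) (hβ0 : β ≠ 0) (hγ0 : γ ≠ 0)
    (hα : IsHomog a α) (hβ : IsHomog b β) (hγ : IsHomog c γ)
    (hdα : dvg α = 0) (hdβ : dvg β = 0) (hdγ : dvg γ = 0) :
    tauA (mul (dvg (mul α β)) γ) +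
        ((-1 : ℂ) ^ a) * tauA (mul α (dvg (mul β γ))) +
        ((-1 : ℂ) ^ ((a + 1) * b)) * tauA (mul β (dvg (mul α γ))) = 0 := by
  rw [← tauA_smul, ← tauA_smul, ← tauA_add, ← tauA_add,
    ← dvg_mul_mul hα.hasParity hβ.hasParity hdα hdβ hdγ, tauA_dvg]

end BCOV
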